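/- arXiv:2501.00416 — 8 statements merged into one kernel-verified Lean document; each statement's English description precedes it below -/
import Mathlib

section
/- Let X be a Lawvere metric space with distance function d : X → X → ℝ≥0∞. Then for all x, x' ∈ X one has ⨆ x'' : X, (d x'' x' ∸ d x'' x) = d x x'. (That is, the Yoneda map x ↦ d(−, x) into the space of ℝ≥0∞-valued functions, equipped with the generalized metric D(f,g) = ⨆ x'', (g x'' ∸ f x''), is an isometry; this generalizes the Kuratowski embedding theorem.) -/
open ENNReal

/-- Yoneda / generalized Kuratowski embedding is an isometry for Lawvere metric spaces. -/
theorem yoneda_isometry_lawvere {X : Type*} (d : X → X → ℝ≥0∞)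
    (refl : ∀ x, d x x = 0)
    (triangle : ∀ x y z, d x z ≤ d x y + d y z) :
    ∀ x x' : X, (⨆ x'' : X, (d x'' x' - d x'' x)) = d x x' := by
  intro x x'
  apply le_antisymm
  · exact iSup_le fun y => tsub_le_iff_left.2 (triangle y x x')
  · simpa [refl] using le_iSup (fun y => d y x' - d y x) x
end

section
/- Let M be a metric space and suppose f, g : M → ℝ both belong to the tight span of M. Then for every real number c, (∀ m, g m − f m ≤ c) holds if and only if (∀ m, f m − g m ≤ c) holds. (Hence the restriction of the asymmetric sup-metric D(f,g) = sup_m max(g m − f m, 0) to the tight span is symmetric; this is the symmetry part of the theorem identifying the tight span inside the Isbell completion.) -/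
/-- Membership in the tight span of a metric space. -/
def InTightSpan {M : Type*} [MetricSpace M] (f : M → ℝ) : Prop :=
  (∀ m m' : M, f m' - f m ≤ dist m m') ∧
    ∀ m : M, IsLUB (Set.range fun m' : M => dist m m' - f m') (f m)

/-- An upper bound for `g - f` on the tight span is also an upper bound for `f - g`. -/
theorem InTightSpan.sub_le_of_forall_sub_le {M : Type*} [MetricSpace M] {f g : M → ℝ}
    (hf : InTightSpan f) (hg : InTightSpan g) {c : ℝ} (h : ∀ m : M, g m - f m ≤ c) (m : M) :
    f m - g m ≤ c := by
  rw [sub_le_iff_le_add]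
  refine (hf.2 m).2 ?_
  rintro _ ⟨m', rfl⟩
  have hm' : dist m m' - g m' ≤ g m := (hg.2 m).1 ⟨m', rfl⟩
  linarith [h m']

/-- The asymmetric sup-metric restricted to the tight span is symmetric. -/
theorem tight_span_symmetric {M : Type*} [MetricSpace M] {f g : M → ℝ}
    (hf : InTightSpan f) (hg : InTightSpan g) :
    ∀ c : ℝ, (∀ m : M, g m - f m ≤ c) ↔ (∀ m : M, f m - g m ≤ c) :=
  fun _ => ⟨hf.sub_le_of_forall_sub_le hg, hg.sub_le_of_forall_sub_le hf⟩
end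

section
/- Let M be a metric space, let f : M → ℝ belong to the tight span of M, and let m ∈ M. Then f m is the least upper bound of the set {|f m' − dist m' m| : m' ∈ M}. (That is, in the tight span with the sup-metric, the distance from f to the image of the point m under the Kuratowski embedding equals f m.) -/
/-- In the tight span, the sup-distance from `f` to the Kuratowski image of `m` is `f m`. -/
theorem tight_span_dist_to_point {M : Type*} [MetricSpace M] {f : M → ℝ}
    (hf : InTightSpan f) (m : M) :
    IsLUB (Set.range fun m' : M => |f m' - dist m' m|) (f m) := by
  refine ⟨?_, fun b hb => (hf.2 m).2 ?_⟩
  · rintro _ ⟨m', rfl⟩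
    have h₁ := hf.1 m m'
    have h₂ : dist m m' - f m' ≤ f m := (hf.2 m).1 ⟨m', rfl⟩
    rw [dist_comm] at h₁ h₂
    exact abs_le.2 ⟨by linarith, by linarith⟩
  · rintro _ ⟨m', rfl⟩
    have h : |f m' - dist m' m| ≤ b := hb ⟨m', rfl⟩
    rw [dist_comm] at h
    have h' := neg_le_abs (f m' - dist m m')
    change dist m m' - f m' ≤ b
    linarith
end

section
/- Let X be a nonempty finite metric space with n points. For t > 0 let Z_t be the real n × n matrix indexed by the points of X with entries Z_t(x, x') = exp(−t · dist x x'). Then there exists T > 0 such that Z_t is invertible for all t ≥ T, and the magnitude function t ↦ ∑_{x,x'} (Z_t)⁻¹(x, x') tends to n (the number of points of X) as t → ∞. -/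
open Filter Matrix

/-- The similarity matrix of a finite metric space at scale `t`. -/
noncomputable def simMatrix (X : Type*) [Fintype X] [MetricSpace X] (t : ℝ) :
    Matrix X X ℝ :=
  Matrix.of fun x x' : X => Real.exp (-t * dist x x')

theorem tendsto_simMatrix_one (X : Type*) [Fintype X] [DecidableEq X] [MetricSpace X] :
    Tendsto (simMatrix X) atTop (nhds 1) := by
  refine tendsto_pi_nhds.2 fun x => tendsto_pi_nhds.2 fun y => ?_
  simp only [simMatrix, Matrix.of_apply]
  rcases eq_or_ne x y with rfl | hxy
  · simp
  · rw [Matrix.one_apply_ne hxy]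
    exact Real.tendsto_exp_atBot.comp
      (tendsto_neg_atTop_atBot.atBot_mul_const (dist_pos.2 hxy))

theorem Matrix.tendsto_inv {ι n K : Type*} [Fintype n] [DecidableEq n] [Field K]
    [TopologicalSpace K] [IsTopologicalRing K] [ContinuousInv₀ K] {l : Filter ι}
    {A : ι → Matrix n n K} {B : Matrix n n K} (h : Tendsto A l (nhds B)) (hB : B.det ≠ 0) :
    Tendsto (fun i => (A i)⁻¹) l (nhds B⁻¹) := by
  simp only [Matrix.inv_def, Ring.inverse_eq_inv']
  exact (((continuous_id.matrix_det.tendsto B).comp h).inv₀ hB).smul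
    ((continuous_id.matrix_adjugate.tendsto B).comp h)

/-- For `t` large the similarity matrix is invertible and the magnitude function
tends to the number of points as `t → ∞`. -/
theorem magnitude_tendsto_card (X : Type*) [Fintype X] [DecidableEq X] [Nonempty X] [MetricSpace X] :
    ∃ T : ℝ, 0 < T ∧ (∀ t : ℝ, T ≤ t → IsUnit (simMatrix X t)) ∧
      Tendsto (fun t : ℝ => ∑ x : X, ∑ x' : X, (simMatrix X t)⁻¹ x x')
        atTop (nhds (Fintype.card X : ℝ)) := by
  have hZ := tendsto_simMatrix_one X
  have hdet : Tendsto (fun t => (simMatrix X t).det) atTop (nhds 1) := by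
    simpa [Function.comp_def] using ((continuous_id.matrix_det (n := X) (R := ℝ)).tendsto 1).comp hZ
  obtain ⟨T, hT⟩ := eventually_atTop.1 (hdet.eventually_ne one_ne_zero)
  refine ⟨max T 1, by positivity, fun t ht => ?_, ?_⟩
  · exact (Matrix.isUnit_iff_isUnit_det _).2 (hT t (le_of_max_le_left ht)).isUnit
  · have hinv := Matrix.tendsto_inv hZ (by simp)
    have hsum : ∑ x : X, ∑ y : X, (1 : Matrix X X ℝ)⁻¹ x y = Fintype.card X := by
      simp [Matrix.one_apply]
    rw [← hsum]
    exact tendsto_finsetSum _ fun x _ => tendsto_finsetSum _ fun y _ =>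
      tendsto_pi_nhds.1 (tendsto_pi_nhds.1 hinv x) y
end

section
/- Let ι be a nonempty finite index type, let x : ι → ℝⁿ (Euclidean space with the Euclidean norm) be an injective family of points, and let t > 0. Then the real matrix M with entries M(i, j) = exp(−t · ‖x i − x j‖) is positive definite. (Consequently every finite subset of Euclidean space has well-defined magnitude at every scale.) -/
open Matrix

namespace Matrix

variable {ι : Type*}

theorem PosSemidef.map_pow [Finite ι] {G : Matrix ι ι ℝ} (hG : G.PosSemidef) (k : ℕ) :
    (G.map (· ^ k)).PosSemidef := by
  induction k with
  | zero =>
    convert posSemidef_vecMulVec_self_star (fun _ : ι => (1 : ℝ)) using 1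
    ext i j
    simp [vecMulVec_apply]
  | succ k ih =>
    have h : G.map (· ^ (k + 1)) = G.map (· ^ k) ⊙ G := by
      ext i j
      simp [pow_succ]
    rw [h]
    exact ih.hadamard hG

theorem dotProduct_mulVec_eq_sum_sum [Fintype ι] (M : Matrix ι ι ℝ) (v : ι → ℝ) :
    v ⬝ᵥ (M *ᵥ v) = ∑ i, ∑ j, v i * (M i j * v j) := by
  simp [dotProduct, mulVec, Finset.mul_sum]

theorem hasSum_dotProduct_map_pow_mulVec [Fintype ι] (G : Matrix ι ι ℝ) (v : ι → ℝ) :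
    HasSum (fun k : ℕ => (k.factorial : ℝ)⁻¹ * (v ⬝ᵥ (G.map (· ^ k) *ᵥ v)))
      (v ⬝ᵥ (G.map Real.exp *ᵥ v)) := by
  simp only [dotProduct_mulVec_eq_sum_sum, Finset.mul_sum, map_apply]
  refine hasSum_sum fun i _ => hasSum_sum fun j _ => ?_
  have h := NormedSpace.expSeries_div_hasSum_exp (G i j)
  rw [← Real.exp_eq_exp_ℝ] at h
  refine ((h.mul_right (v j)).mul_left (v i)).congr_fun fun k => ?_
  ring

theorem PosSemidef.inv_factorial_mul_map_pow_nonneg [Fintype ι] {G : Matrix ι ι ℝ}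
    (hG : G.PosSemidef) (v : ι → ℝ) (k : ℕ) :
    0 ≤ (k.factorial : ℝ)⁻¹ * (v ⬝ᵥ (G.map (· ^ k) *ᵥ v)) :=
  mul_nonneg (by positivity) (by simpa using (hG.map_pow k).dotProduct_mulVec_nonneg v)

theorem PosSemidef.map_exp_sub_one [Fintype ι] {G : Matrix ι ι ℝ} (hG : G.PosSemidef) :
    (G.map fun a => Real.exp a - 1).PosSemidef := by
  refine .of_dotProduct_mulVec_nonneg ?_ fun v => ?_
  · ext i j
    simpa using congrArg Real.exp (hG.isHermitian.apply i j)
  · have h := le_hasSum (hasSum_dotProduct_map_pow_mulVec G v) 0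
      fun k _ => hG.inv_factorial_mul_map_pow_nonneg v k
    simp only [dotProduct_mulVec_eq_sum_sum, map_apply, star_trivial, pow_zero, Nat.factorial_zero,
      Nat.cast_one, inv_one, one_mul] at h ⊢
    simpa [sub_mul, mul_sub, Finset.sum_sub_distrib] using h

/-- The entrywise exponential of a positive semidefinite matrix that separates indices is positive
definite. -/
theorem PosSemidef.map_exp_posDef [Fintype ι] {G : Matrix ι ι ℝ} (hG : G.PosSemidef)
    (hsep : ∀ i j, i ≠ j → 2 * G i j < G i i + G j j) : (G.map Real.exp).PosDef := by
  classical
  refine .of_dotProduct_mulVec_pos ?_ fun v hv => ?_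
  · ext i j
    simpa using congrArg Real.exp (hG.isHermitian.apply i j)
  have hsum := hasSum_dotProduct_map_pow_mulVec G v
  have hterm := hG.inv_factorial_mul_map_pow_nonneg v
  rw [star_trivial]
  refine (hsum.nonneg hterm).lt_of_ne' fun h0 => ?_
  rw [h0, hasSum_zero_iff_of_nonneg hterm] at hsum
  have hker (k : ℕ) : G.map (· ^ k) *ᵥ v = 0 := by
    rw [← (hG.map_pow k).dotProduct_mulVec_zero_iff, star_trivial]
    have h := congrFun hsum k
    simpa [Nat.factorial_ne_zero] using h
  have hpoly (p : Polynomial ℝ) (i : ι) : ∑ j, p.eval (G i j) * v j = 0 := by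
    simp only [Polynomial.eval_eq_sum_range, Finset.sum_mul]
    rw [Finset.sum_comm]
    refine Finset.sum_eq_zero fun k _ => ?_
    simpa [mulVec, dotProduct, Finset.mul_sum, mul_assoc] using
      congrArg (p.coeff k * ·) (congrFun (hker k) i)
  obtain ⟨i₀, hi₀⟩ := Function.ne_iff.mp hv
  obtain ⟨i, hi, hmax⟩ := Finset.exists_max_image (Finset.univ.filter (v · ≠ 0)) (fun i => G i i)
    ⟨i₀, by simpa using hi₀⟩
  simp only [Finset.mem_filter, Finset.mem_univ, true_and] at hi hmax
  have hlt (j : ι) (hj : v j ≠ 0) (hij : i ≠ j) : G i j < G i i := by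
    linarith [hsep i j hij, hmax j hj]
  have h := hpoly (∏ j with v j ≠ 0 ∧ i ≠ j, (Polynomial.X - Polynomial.C (G i j))) i
  rw [Finset.sum_eq_single i] at h
  · refine (mul_ne_zero ?_ hi) h
    rw [Polynomial.eval_prod, Finset.prod_ne_zero_iff]
    intro j hj
    simp only [Finset.mem_filter, Finset.mem_univ, true_and] at hj
    simpa using (sub_pos.mpr (hlt j hj.1 hj.2)).ne'
  · intro j _ hji
    by_cases hj : v j = 0
    · simp [hj]
    · rw [Polynomial.eval_prod, Finset.prod_eq_zero (i := j)]
      · simp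
      · simp [hj, hji.symm]
      · simp
  · simp

theorem PosDef.mul_mul_of_ne_zero [Fintype ι] {M : Matrix ι ι ℝ} (hM : M.PosDef) {d : ι → ℝ}
    (hd : ∀ i, d i ≠ 0) : (of fun i j => d i * M i j * d j).PosDef := by
  classical
  have hinj : Function.Injective (diagonal d).mulVec := fun v w h => funext fun i => by
    simpa [mulVec_diagonal, hd i] using congrFun h i
  convert hM.conjTranspose_mul_mul_same hinj using 1
  ext i j
  simp

end Matrix

section NormIntegral

open MeasureTheory

theorem one_sub_exp_neg_sq_div_sq_nonneg (u : ℝ) : 0 ≤ (1 - Real.exp (-u ^ 2)) / u ^ 2 :=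
  div_nonneg (sub_nonneg.mpr (Real.exp_le_one_iff.mpr (by nlinarith [sq_nonneg u]))) (sq_nonneg u)

theorem one_sub_exp_neg_sq_div_sq_le (u : ℝ) :
    (1 - Real.exp (-u ^ 2)) / u ^ 2 ≤ 2 * (1 + u ^ 2)⁻¹ := by
  rcases eq_or_ne u 0 with rfl | hu
  · simp
  have hpos : 0 < u ^ 2 := by positivity
  rw [← div_eq_mul_inv, div_le_div_iff₀ hpos (by positivity)]
  rcases le_total (u ^ 2) 1 with h | h
  · nlinarith [Real.add_one_le_exp (-u ^ 2)]
  · nlinarith [Real.exp_pos (-u ^ 2)]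

theorem integrable_one_sub_exp_neg_sq_div_sq :
    Integrable fun u : ℝ => (1 - Real.exp (-u ^ 2)) / u ^ 2 := by
  refine (integrable_inv_one_add_sq.const_mul 2).mono' ?_ (.of_forall fun u => ?_)
  · exact Measurable.aestronglyMeasurable (by fun_prop)
  · rw [Real.norm_of_nonneg (one_sub_exp_neg_sq_div_sq_nonneg u)]
    exact one_sub_exp_neg_sq_div_sq_le u

theorem integral_one_sub_exp_neg_sq_div_sq_pos :
    0 < ∫ u : ℝ, (1 - Real.exp (-u ^ 2)) / u ^ 2 := by
  rw [integral_pos_iff_support_of_nonneg one_sub_exp_neg_sq_div_sq_nonneg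
    integrable_one_sub_exp_neg_sq_div_sq]
  refine lt_of_lt_of_le ?_ (measure_mono (show Set.Ioo (0 : ℝ) 1 ⊆ _ from fun u hu => ?_))
  · simp
  · have hpos : 0 < u ^ 2 := pow_pos hu.1 2
    exact (div_pos (sub_pos.mpr (Real.exp_lt_one_iff.mpr (by linarith))) hpos).ne'

theorem one_sub_exp_neg_mul_sq_div_sq_eq (r u : ℝ) :
    (1 - Real.exp (-(u * r) ^ 2)) / u ^ 2 =
      r ^ 2 * ((1 - Real.exp (-(u * r) ^ 2)) / (u * r) ^ 2) := by
  rcases eq_or_ne r 0 with rfl | hr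
  · simp
  · field_simp

theorem integrable_one_sub_exp_neg_mul_sq_div_sq (r : ℝ) :
    Integrable fun u : ℝ => (1 - Real.exp (-(u * r) ^ 2)) / u ^ 2 := by
  rcases eq_or_ne r 0 with rfl | hr
  · simp
  simp_rw [one_sub_exp_neg_mul_sq_div_sq_eq r]
  exact (integrable_one_sub_exp_neg_sq_div_sq.comp_mul_right' hr).const_mul _

theorem integral_one_sub_exp_neg_mul_sq_div_sq {r : ℝ} (hr : 0 ≤ r) :
    ∫ u : ℝ, (1 - Real.exp (-(u * r) ^ 2)) / u ^ 2 =
      r * ∫ u : ℝ, (1 - Real.exp (-u ^ 2)) / u ^ 2 := by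
  simp_rw [one_sub_exp_neg_mul_sq_div_sq_eq r]
  rw [integral_const_mul,
    Measure.integral_comp_mul_right (fun u => (1 - Real.exp (-u ^ 2)) / u ^ 2) r,
    abs_of_nonneg (inv_nonneg.mpr hr), smul_eq_mul, ← mul_assoc]
  rcases hr.eq_or_lt with rfl | hr
  · simp
  · congr 1
    field_simp

end NormIntegral

section InnerProductSpace

open MeasureTheory

variable {ι E : Type*} [NormedAddCommGroup E] [InnerProductSpace ℝ E]

theorem posSemidef_gaussian_sub [Fintype ι] (x : ι → E) (u : ℝ) :
    (of fun i j => (1 - Real.exp (-(u * ‖x i‖) ^ 2)) + (1 - Real.exp (-(u * ‖x j‖) ^ 2)) -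
      (1 - Real.exp (-(u * ‖x i - x j‖) ^ 2))).PosSemidef := by
  have hgram := ((posSemidef_gram ℝ x).smul (show 0 ≤ 2 * u ^ 2 by positivity)).map_exp_sub_one
  convert (posSemidef_vecMulVec_self_star fun i => 1 - Real.exp (-(u * ‖x i‖) ^ 2)).add
    ((posSemidef_vecMulVec_self_star fun i => Real.exp (-(u * ‖x i‖) ^ 2)).hadamard hgram) using 1
  ext i j
  have h : Real.exp (-(u * ‖x i - x j‖) ^ 2) = Real.exp (-(u * ‖x i‖) ^ 2) *
      Real.exp (-(u * ‖x j‖) ^ 2) * Real.exp (2 * u ^ 2 * inner ℝ (x i) (x j)) := by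
    rw [← Real.exp_add, ← Real.exp_add, mul_pow u ‖x i - x j‖, norm_sub_sq_real]
    congr 1
    ring
  simp only [of_apply, Matrix.add_apply, hadamard_apply, vecMulVec_apply, map_apply,
    Matrix.smul_apply, gram_apply, smul_eq_mul, star_trivial, h]
  ring

theorem posSemidef_norm_add_norm_sub_norm_sub [Fintype ι] (x : ι → E) :
    (of fun i j => ‖x i‖ + ‖x j‖ - ‖x i - x j‖).PosSemidef := by
  refine .of_dotProduct_mulVec_nonneg ?_ fun v => ?_
  · ext i j
    simp [norm_sub_rev (x j), add_comm]
  rw [star_trivial, dotProduct_mulVec_eq_sum_sum]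
  refine nonneg_of_mul_nonneg_left ?_ integral_one_sub_exp_neg_sq_div_sq_pos
  have hgauss := integrable_one_sub_exp_neg_mul_sq_div_sq
  have hentry (i j : ι) :
      (‖x i‖ + ‖x j‖ - ‖x i - x j‖) * ∫ u : ℝ, (1 - Real.exp (-u ^ 2)) / u ^ 2 =
        ∫ u : ℝ, ((1 - Real.exp (-(u * ‖x i‖) ^ 2)) / u ^ 2 +
          (1 - Real.exp (-(u * ‖x j‖) ^ 2)) / u ^ 2 -
          (1 - Real.exp (-(u * ‖x i - x j‖) ^ 2)) / u ^ 2) := by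
    rw [integral_sub (by exact (hgauss _).add (hgauss _)) (hgauss _),
      integral_add (hgauss _) (hgauss _)]
    simp only [integral_one_sub_exp_neg_mul_sq_div_sq (norm_nonneg _)]
    ring
  have hentry_integrable (i j : ι) : Integrable fun u : ℝ =>
      v i * (((1 - Real.exp (-(u * ‖x i‖) ^ 2)) / u ^ 2 +
        (1 - Real.exp (-(u * ‖x j‖) ^ 2)) / u ^ 2 -
        (1 - Real.exp (-(u * ‖x i - x j‖) ^ 2)) / u ^ 2) * v j) :=
    ((((hgauss ‖x i‖).add (hgauss ‖x j‖)).sub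
    (hgauss ‖x i - x j‖)).mul_const (v j)).const_mul (v i)
  calc
    0 ≤ ∫ u : ℝ, ∑ i, ∑ j, v i * (((1 - Real.exp (-(u * ‖x i‖) ^ 2)) / u ^ 2 +
          (1 - Real.exp (-(u * ‖x j‖) ^ 2)) / u ^ 2 -
          (1 - Real.exp (-(u * ‖x i - x j‖) ^ 2)) / u ^ 2) * v j) := by
      refine integral_nonneg fun u => ?_
      have h := (posSemidef_gaussian_sub x u).dotProduct_mulVec_nonneg v
      rw [star_trivial, dotProduct_mulVec_eq_sum_sum] at h
      refine (mul_nonneg (inv_nonneg.mpr (sq_nonneg u)) h).trans_eq ?_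
      simp only [Finset.mul_sum, of_apply]
      refine Finset.sum_congr rfl fun i _ => Finset.sum_congr rfl fun j _ => ?_
      ring
    _ = _ := by
      rw [integral_finsetSum _ fun i _ => integrable_finsetSum _ fun j _ => hentry_integrable i j,
        Finset.sum_mul]
      refine Finset.sum_congr rfl fun i _ => ?_
      rw [integral_finsetSum _ fun j _ => hentry_integrable i j, Finset.sum_mul]
      refine Finset.sum_congr rfl fun j _ => ?_
      rw [integral_const_mul, integral_mul_const, ← hentry, of_apply]
      ring

end InnerProductSpace

/-- The similarity matrix of a finite family of distinct points in Euclidean space is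
positive definite. -/
theorem euclidean_simMatrix_posDef {n : ℕ} {ι : Type*} [Fintype ι] [Nonempty ι]
    (x : ι → EuclideanSpace ℝ (Fin n)) (hx : Function.Injective x)
    {t : ℝ} (ht : 0 < t) :
    (Matrix.of fun i j : ι => Real.exp (-t * ‖x i - x j‖)).PosDef := by
  have hexp := ((posSemidef_norm_add_norm_sub_norm_sub x).smul ht.le).map_exp_posDef
    fun i j hij => by
      have hpos : 0 < t * ‖x i - x j‖ := mul_pos ht (norm_pos_iff.mpr (sub_ne_zero.mpr (hx.ne hij)))
      simp only [Matrix.smul_apply, of_apply, smul_eq_mul, sub_self, norm_zero]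
      linarith
  convert hexp.mul_mul_of_ne_zero (d := fun i => Real.exp (-t * ‖x i‖))
    fun i => (Real.exp_pos _).ne' using 1
  ext i j
  simp only [of_apply, map_apply, Matrix.smul_apply, smul_eq_mul, ← Real.exp_add]
  congr 1
  ring
end

section
/- Let X be a nonempty finite metric space all of whose distances are natural numbers, i.e. for all x, y there is d(x,y) ∈ ℕ with dist x y = d(x,y) (for example, a finite connected graph with the shortest-path metric). Then there exist polynomials p, r ∈ ℤ[q] with constant coefficient of r equal to 1, such that for every t > 0 for which the similarity matrix Z_t (with entries exp(−t · dist x y)) is invertible, the magnitude satisfies ∑_{x,y} (Z_t)⁻¹(x, y) = p(e^{−t}) / r(e^{−t}). (Hence, writing q = e^{−t}, the magnitude function of a graph is a rational function of q expandable as an integer power series in q.) -/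
open Matrix Polynomial

/-- The similarity matrix over `ℤ[q]`, with entries `q ^ d x y`. -/
noncomputable def polySimMatrix {V : Type*} (d : V → V → ℕ) : Matrix V V ℤ[X] :=
  Matrix.of fun x y => (Polynomial.X : ℤ[X]) ^ d x y

theorem coeff_zero_det_polySimMatrix {V : Type*} [Fintype V] [DecidableEq V]
    (d : V → V → ℕ) (hd : ∀ x y, d x y = 0 ↔ x = y) :
    (polySimMatrix d).det.coeff 0 = 1 := by
  have h : (Polynomial.constantCoeff (R := ℤ)).mapMatrix (polySimMatrix d) = 1 := by
    ext x y
    by_cases hxy : x = y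
    · subst hxy
      simp [polySimMatrix, (hd x x).2 rfl]
    · simp [polySimMatrix, hxy, Ne.symm (mt (hd x y).1 hxy)]
  rw [← Polynomial.constantCoeff_apply, RingHom.map_det, h, Matrix.det_one]

theorem aeval_mapMatrix_polySimMatrix {V : Type*} [Fintype V] [DecidableEq V] [MetricSpace V]
    (d : V → V → ℕ) (hd : ∀ x y : V, dist x y = (d x y : ℝ)) (t : ℝ) :
    (Polynomial.aeval (R := ℤ) (Real.exp (-t))).mapMatrix (polySimMatrix d) = simMatrix V t := by
  ext x y
  simp [polySimMatrix, simMatrix, hd, ← Real.exp_nat_mul, mul_comm]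

/-- For a finite metric space with natural-number distances (e.g. a finite connected
graph with the shortest-path metric), the magnitude function is a rational function
of `q = e^{-t}` whose denominator has constant coefficient `1` (hence it is
expandable as an integer power series in `q`). -/
theorem graph_magnitude_rational (X : Type*) [Fintype X] [DecidableEq X] [Nonempty X]
    [MetricSpace X] (d : X → X → ℕ) (hd : ∀ x y : X, dist x y = (d x y : ℝ)) :
    ∃ p r : Polynomial ℤ, r.coeff 0 = 1 ∧
      ∀ t : ℝ, 0 < t → IsUnit (simMatrix X t).det →
        (∑ x : X, ∑ y : X, (simMatrix X t)⁻¹ x y) =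
          (Polynomial.aeval (Real.exp (-t)) p : ℝ) /
            (Polynomial.aeval (Real.exp (-t)) r : ℝ) := by
  have hd₀ : ∀ x y, d x y = 0 ↔ x = y := fun x y => by
    rw [← dist_eq_zero (x := x), hd, Nat.cast_eq_zero]
  refine ⟨∑ x, ∑ y, (polySimMatrix d).adjugate x y, (polySimMatrix d).det,
    coeff_zero_det_polySimMatrix d hd₀, fun t _ _ => ?_⟩
  have hadj (x y : X) : Polynomial.aeval (Real.exp (-t)) ((polySimMatrix d).adjugate x y) =
      (simMatrix X t).adjugate x y := by
    rw [← aeval_mapMatrix_polySimMatrix d hd t, ← AlgHom.map_adjugate]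
    rfl
  rw [AlgHom.map_det, aeval_mapMatrix_polySimMatrix d hd t]
  simp only [map_sum, hadj, Matrix.inv_def, Ring.inverse_eq_inv', Matrix.smul_apply, smul_eq_mul,
    ← Finset.mul_sum, div_eq_inv_mul]
end

section
/- (Fenchel–Moreau duality.) Let E be a real normed vector space with continuous dual E*, and let f : E → EReal satisfy: (i) f x ≠ −∞ for all x; (ii) f is lower semicontinuous; (iii) f is convex, i.e. f(θ·x + (1−θ)·y) ≤ (θ : EReal)·f(x) + ((1−θ) : EReal)·f(y) for all x, y ∈ E and θ ∈ [0,1]. Then f** = f, i.e. for every x ∈ E, ⨆ k : E*, ((k x : EReal) − f*(k)) = f x. (The Legendre–Fenchel transform restricts to a bijection between closed convex functions on E and on E*.) -/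
/-- The Legendre–Fenchel conjugate of `f : E → EReal`. -/
noncomputable def fenchel {E : Type*} [NormedAddCommGroup E] [NormedSpace ℝ E]
    (f : E → EReal) : (E →L[ℝ] ℝ) → EReal :=
  fun k => ⨆ x : E, ((k x : EReal) - f x)

/-- The real epigraph of a lower semicontinuous `EReal`-valued function is closed. -/
theorem isClosed_realEpigraph {E : Type*} [TopologicalSpace E] {f : E → EReal}
    (hlsc : LowerSemicontinuous f) :
    IsClosed {p : E × ℝ | f p.1 ≤ (p.2 : EReal)} :=
  hlsc.isClosed_epigraph.preimage
    (continuous_fst.prodMk (continuous_coe_real_ereal.comp continuous_snd))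

section FenchelMoreau

variable {E : Type*} [NormedAddCommGroup E] [NormedSpace ℝ E] {f : E → EReal}

/-- The real epigraph of a convex `EReal`-valued function is convex. -/
theorem convex_realEpigraph
    (hconv : ∀ (x y : E) (θ : ℝ), 0 ≤ θ → θ ≤ 1 →
      f (θ • x + (1 - θ) • y) ≤ (θ : EReal) * f x + ((1 - θ : ℝ) : EReal) * f y) :
    Convex ℝ {p : E × ℝ | f p.1 ≤ (p.2 : EReal)} := by
  rintro ⟨x, r⟩ hx ⟨y, t⟩ hy a b ha hb hab
  obtain rfl : b = 1 - a := by linarith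
  have h := (hconv x y a ha (by linarith)).trans (add_le_add
    (mul_le_mul_of_nonneg_left hx (EReal.coe_nonneg.2 ha))
    (mul_le_mul_of_nonneg_left hy (EReal.coe_nonneg.2 hb)))
  simpa using h

/-- A point strictly below the graph is separated from the real epigraph by a closed hyperplane
`{(y, r) | h y + s * r = u}` with `s ≤ 0`. -/
theorem exists_separating_of_lt (hlsc : LowerSemicontinuous f)
    (hconv : ∀ (x y : E) (θ : ℝ), 0 ≤ θ → θ ≤ 1 →
      f (θ • x + (1 - θ) • y) ≤ (θ : EReal) * f x + ((1 - θ : ℝ) : EReal) * f y)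
    {x₀ : E} {r₀ : ℝ} (h₀ : f x₀ ≤ r₀) {x : E} {a : ℝ} (hax : (a : EReal) < f x) :
    ∃ (h : E →L[ℝ] ℝ) (s u : ℝ), s ≤ 0 ∧ (∀ (y : E) (r : ℝ), f y ≤ r → h y + s * r < u) ∧
      u < h x + s * a := by
  obtain ⟨g, u, hg, hu⟩ := geometric_hahn_banach_closed_point (x := (x, a))
    (convex_realEpigraph hconv) (isClosed_realEpigraph hlsc) (not_le.2 hax)
  have hsplit (y : E) (r : ℝ) :
      g (y, r) = g.comp (ContinuousLinearMap.inl ℝ E ℝ) y + g (0, 1) * r := by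
    have h1 : ((y, r) : E × ℝ) = (y, 0) + r • ((0, 1) : E × ℝ) := by simp
    rw [h1, map_add, map_smul, smul_eq_mul, mul_comm r]
    rfl
  have hepi (y : E) (r : ℝ) (hr : f y ≤ r) :
      g.comp (ContinuousLinearMap.inl ℝ E ℝ) y + g (0, 1) * r < u :=
    hsplit y r ▸ hg (y, r) hr
  refine ⟨g.comp (ContinuousLinearMap.inl ℝ E ℝ), g (0, 1), u, ?_, hepi, hsplit x a ▸ hu⟩
  by_contra! hs
  set h := g.comp (ContinuousLinearMap.inl ℝ E ℝ)
  have h1 := hepi x₀ (max r₀ ((u - h x₀) / g (0, 1)))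
    (h₀.trans (EReal.coe_le_coe_iff.2 (le_max_left _ _)))
  have h2 := mul_le_mul_of_nonneg_left (le_max_right r₀ ((u - h x₀) / g (0, 1))) hs.le
  rw [mul_div_cancel₀ _ hs.ne'] at h2
  linarith

/-- A non-vertical separating hyperplane is the graph of a continuous affine minorant. -/
theorem exists_affine_minorant_of_separating {h : E →L[ℝ] ℝ} {s u a : ℝ} {x : E} (hs : s < 0)
    (hepi : ∀ (y : E) (r : ℝ), f y ≤ r → h y + s * r < u) (hu : u < h x + s * a) :
    ∃ (k : E →L[ℝ] ℝ) (c : ℝ), (∀ (y : E) (r : ℝ), f y ≤ r → k y + c ≤ r) ∧ a < k x + c := by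
  have key (y : E) : (-s⁻¹ • h) y + u / s = (u - h y) / s := by
    simp only [smul_apply, smul_eq_mul]
    ring
  refine ⟨-s⁻¹ • h, u / s, fun y r hr => ?_, ?_⟩
  · rw [key, div_le_iff_of_neg hs]
    linarith [hepi y r hr]
  · rw [key, lt_div_iff_of_neg hs]
    linarith

/-- A proper lower semicontinuous convex function is the supremum of its continuous affine
minorants. -/
theorem exists_affine_minorant_of_lt (hbot : ∀ x : E, f x ≠ ⊥) (hlsc : LowerSemicontinuous f)
    (hconv : ∀ (x y : E) (θ : ℝ), 0 ≤ θ → θ ≤ 1 →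
      f (θ • x + (1 - θ) • y) ≤ (θ : EReal) * f x + ((1 - θ : ℝ) : EReal) * f y)
    {x₀ : E} (h₀ : f x₀ ≠ ⊤) {x : E} {a : ℝ} (hax : (a : EReal) < f x) :
    ∃ (k : E →L[ℝ] ℝ) (c : ℝ), (∀ (y : E) (r : ℝ), f y ≤ r → k y + c ≤ r) ∧ a < k x + c := by
  obtain ⟨r₀, hr₀⟩ : ∃ r₀ : ℝ, f x₀ = r₀ := ⟨_, (EReal.coe_toReal h₀ (hbot x₀)).symm⟩
  obtain ⟨h, s, u, hs, hepi, hu⟩ := exists_separating_of_lt hlsc hconv hr₀.le hax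
  rcases hs.lt_or_eq with hs | rfl
  · exact exists_affine_minorant_of_separating hs hepi hu
  obtain ⟨h', s', u', hs', hepi', hu'⟩ := exists_separating_of_lt (x := x₀) (a := r₀ - 1)
    hlsc hconv hr₀.le (by rw [hr₀]; exact EReal.coe_lt_coe_iff.2 (by linarith))
  have hs'_neg : s' < 0 := by linarith [hepi' x₀ r₀ hr₀.le]
  obtain ⟨k, c, hk, -⟩ := exists_affine_minorant_of_separating hs'_neg hepi' hu'
  have hpos : 0 < h x - u := by linarith
  obtain ⟨n, hn⟩ := exists_nat_gt ((a - k x - c) / (h x - u))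
  rw [div_lt_iff₀ hpos] at hn
  refine ⟨k + (n : ℝ) • h, c - n * u, fun y r hr => ?_, ?_⟩
  · have h1 : h y ≤ u := by linarith [hepi y r hr]
    have h2 := mul_le_mul_of_nonneg_left h1 (Nat.cast_nonneg (α := ℝ) n)
    simp only [add_apply, smul_apply, smul_eq_mul]
    linarith [hk y r hr]
  · simp only [add_apply, smul_apply, smul_eq_mul]
    linarith

/-- The Fenchel–Young inequality, in the form `f** ≤ f`. -/
theorem coe_sub_fenchel_le (hbot : ∀ x : E, f x ≠ ⊥) (k : E →L[ℝ] ℝ) (x : E) :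
    (k x : EReal) - fenchel f k ≤ f x := by
  have h : (k x : EReal) - f x ≤ fenchel f k := le_iSup (fun y => (k y : EReal) - f y) x
  by_cases htop : f x = ⊤
  · simp [htop]
  obtain ⟨r, hr⟩ : ∃ r : ℝ, f x = r := ⟨_, (EReal.coe_toReal htop (hbot x)).symm⟩
  rw [hr] at h ⊢
  refine (EReal.sub_le_sub le_rfl h).trans_eq ?_
  norm_cast
  ring

/-- A continuous affine minorant with slope `k` bounds the conjugate at `k`. -/
theorem fenchel_le_of_affine_minorant (hbot : ∀ x : E, f x ≠ ⊥) {k : E →L[ℝ] ℝ} {c : ℝ}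
    (hk : ∀ (y : E) (r : ℝ), f y ≤ r → k y + c ≤ r) : fenchel f k ≤ ((-c : ℝ) : EReal) := by
  refine iSup_le fun y => ?_
  by_cases htop : f y = ⊤
  · simp [htop]
  obtain ⟨r, hr⟩ : ∃ r : ℝ, f y = r := ⟨_, (EReal.coe_toReal htop (hbot y)).symm⟩
  rw [hr, ← EReal.coe_sub, EReal.coe_le_coe_iff]
  linarith [hk y r hr.le]

end FenchelMoreau

/-- Fenchel–Moreau duality: a nowhere `-∞`, lower semicontinuous, convex function
equals its double Legendre–Fenchel transform. -/
theorem fenchel_moreau {E : Type*} [NormedAddCommGroup E] [NormedSpace ℝ E]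
    (f : E → EReal) (hbot : ∀ x : E, f x ≠ ⊥)
    (hlsc : LowerSemicontinuous f)
    (hconv : ∀ (x y : E) (θ : ℝ), 0 ≤ θ → θ ≤ 1 →
      f (θ • x + (1 - θ) • y) ≤ (θ : EReal) * f x + ((1 - θ : ℝ) : EReal) * f y) :
    ∀ x : E, (⨆ k : E →L[ℝ] ℝ, ((k x : EReal) - fenchel f k)) = f x := by
  intro x
  refine le_antisymm (iSup_le fun k => coe_sub_fenchel_le hbot k x) ?_
  by_cases hproper : ∃ x₀, f x₀ ≠ ⊤
  · obtain ⟨x₀, h₀⟩ := hproper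
    refine EReal.ge_of_forall_gt_iff_ge.1 fun a ha => ?_
    obtain ⟨k, c, hk, hkx⟩ := exists_affine_minorant_of_lt hbot hlsc hconv h₀ ha
    refine le_iSup_of_le k (le_trans ?_
      (EReal.sub_le_sub le_rfl (fenchel_le_of_affine_minorant hbot hk)))
    rw [← EReal.coe_sub, EReal.coe_le_coe_iff]
    linarith
  · push Not at hproper
    refine le_iSup_of_le 0 ?_
    simp [fenchel, hproper]
end

section
/- (Toland–Singer duality; the Legendre–Fenchel transform is an isometry on closed convex functions.) Let E be a real normed vector space with continuous dual E*. Let f, f' : E → EReal satisfy f x ≠ −∞ and f' x ≠ −∞ for all x, and suppose f' is lower semicontinuous and convex (f'(θ·x + (1−θ)·y) ≤ (θ : EReal)·f'(x) + ((1−θ) : EReal)·f'(y) for θ ∈ [0,1]). Then ⨆ x : E, (f' x − f x) = ⨆ k : E*, (f*(k) − f'*(k)), where f*(k) = ⨆ x, ((k x : EReal) − f x). (Thus the generalized asymmetric distance D(f, f') = sup_x (f'(x) − f(x)) on functions is preserved, with direction reversed, by the Legendre–Fenchel transform.) -/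
theorem EReal.convex_epigraph {E : Type*} [AddCommGroup E] [Module ℝ E] {g : E → EReal}
    (hconv : ∀ (x y : E) (θ : ℝ), 0 ≤ θ → θ ≤ 1 →
      g (θ • x + (1 - θ) • y) ≤ (θ : EReal) * g x + ((1 - θ : ℝ) : EReal) * g y) :
    Convex ℝ {p : E × ℝ | g p.1 ≤ (p.2 : EReal)} := by
  rintro ⟨x, s⟩ hx ⟨y, t⟩ hy a b ha hb hab
  obtain rfl : b = 1 - a := by linarith
  simp only [Set.mem_ofPred_eq] at hx hy
  have ha' : (0 : EReal) ≤ (a : EReal) := by exact_mod_cast ha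
  have hb' : (0 : EReal) ≤ ((1 - a : ℝ) : EReal) := by exact_mod_cast hb
  calc g (a • x + (1 - a) • y)
      ≤ (a : EReal) * g x + ((1 - a : ℝ) : EReal) * g y := hconv x y a ha (by linarith)
    _ ≤ (a : EReal) * (s : EReal) + ((1 - a : ℝ) : EReal) * (t : EReal) :=
        add_le_add (mul_le_mul_of_nonneg_left hx ha') (mul_le_mul_of_nonneg_left hy hb')
    _ = ((a • s + (1 - a) • t : ℝ) : EReal) := by
        simp only [smul_eq_mul, EReal.coe_add, EReal.coe_mul]

section AffineMinorant

variable {E : Type*} [NormedAddCommGroup E] [NormedSpace ℝ E] {g : E → EReal}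

/-- Separation of a point strictly below the graph from the epigraph. -/
theorem exists_separation_epigraph (hlsc : LowerSemicontinuous g)
    (hconv : ∀ (x y : E) (θ : ℝ), 0 ≤ θ → θ ≤ 1 →
      g (θ • x + (1 - θ) • y) ≤ (θ : EReal) * g x + ((1 - θ : ℝ) : EReal) * g y)
    {x : E} {r : ℝ} (hr : (r : EReal) < g x) :
    ∃ (h : E →L[ℝ] ℝ) (a u : ℝ), h x + a * r < u ∧
      ∀ (y : E) (t : ℝ), g y ≤ (t : EReal) → u < h y + a * t := by
  have hclosed : IsClosed {p : E × ℝ | g p.1 ≤ (p.2 : EReal)} :=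
    hlsc.isClosed_epigraph.preimage
      (f := fun p : E × ℝ => (p.1, (p.2 : EReal)))
      (continuous_fst.prodMk (continuous_coe_real_ereal.comp continuous_snd))
  obtain ⟨φ, u, hu, hφ⟩ := geometric_hahn_banach_point_closed (EReal.convex_epigraph hconv)
    hclosed (x := (x, r)) (by simpa using hr)
  have key (y : E) (t : ℝ) :
      φ (y, t) = φ.comp (ContinuousLinearMap.inl ℝ E ℝ) y + φ (0, 1) * t := by
    have hy : (y, t) = (y, (0 : ℝ)) + t • ((0 : E), (1 : ℝ)) := by simp
    rw [hy, map_add, map_smul, smul_eq_mul, mul_comm]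
    rfl
  exact ⟨_, _, u, by rwa [← key], fun y t hy => by rw [← key]; exact hφ _ hy⟩

theorem exists_affine_le_of_separation {x : E} {r a u : ℝ} {h : E →L[ℝ] ℝ}
    (hbot : ∀ y, g y ≠ ⊥) (ha : 0 < a) (hx : h x + a * r < u)
    (hg : ∀ (y : E) (t : ℝ), g y ≤ (t : EReal) → u < h y + a * t) :
    ∃ (k : E →L[ℝ] ℝ) (c : ℝ), r ≤ k x + c ∧ ∀ y, ((k y + c : ℝ) : EReal) ≤ g y := by
  have eval (y : E) : (-a⁻¹ • h) y + a⁻¹ * u = (u - h y) / a := by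
    simp only [smul_apply, smul_eq_mul]
    field_simp
    ring
  refine ⟨-a⁻¹ • h, a⁻¹ * u, ?_, fun y => ?_⟩
  · rw [eval, le_div_iff₀ ha]
    linarith
  · rw [eval]
    by_cases htop : g y = ⊤
    · simp [htop]
    · lift g y to ℝ using ⟨htop, hbot y⟩ with t ht
      have := hg y t ht.ge
      rw [EReal.coe_le_coe_iff, div_le_iff₀ ha]
      linarith

/-- A lower semicontinuous convex function without the value `⊥` is the supremum of its
continuous affine minorants. -/
theorem exists_affine_le_of_lt (hbot : ∀ y, g y ≠ ⊥) (hlsc : LowerSemicontinuous g)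
    (hconv : ∀ (x y : E) (θ : ℝ), 0 ≤ θ → θ ≤ 1 →
      g (θ • x + (1 - θ) • y) ≤ (θ : EReal) * g x + ((1 - θ : ℝ) : EReal) * g y)
    {x : E} {r : ℝ} (hr : (r : EReal) < g x) :
    ∃ (k : E →L[ℝ] ℝ) (c : ℝ), r ≤ k x + c ∧ ∀ y, ((k y + c : ℝ) : EReal) ≤ g y := by
  by_cases hdom : ∀ y, g y = ⊤
  · exact ⟨0, r, by simp, fun y => by simp [hdom y]⟩
  push Not at hdom
  obtain ⟨y₀, hy₀⟩ := hdom
  obtain ⟨t₀, ht₀⟩ : ∃ t : ℝ, (t : EReal) = g y₀ := ⟨_, EReal.coe_toReal hy₀ (hbot y₀)⟩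
  obtain ⟨h, a, u, hx, hg⟩ := exists_separation_epigraph hlsc hconv hr
  have ha : 0 ≤ a := by
    by_contra! ha
    have h₁ := hg y₀ (max t₀ ((u - h y₀) / a)) (ht₀ ▸ by exact_mod_cast le_max_left _ _)
    have h₂ := mul_le_mul_of_nonpos_left (le_max_right t₀ ((u - h y₀) / a)) ha.le
    rw [mul_div_cancel₀ _ ha.ne] at h₂
    linarith
  rcases ha.lt_or_eq with ha | rfl
  · exact exists_affine_le_of_separation hbot ha hx hg
  · obtain ⟨k, c, hkc⟩ : ∃ (k : E →L[ℝ] ℝ) (c : ℝ), ∀ y, ((k y + c : ℝ) : EReal) ≤ g y := by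
      obtain ⟨h', a', u', hx', hg'⟩ := exists_separation_epigraph hlsc hconv
        (x := y₀) (r := t₀ - 1) (by rw [← ht₀]; exact_mod_cast sub_one_lt t₀)
      have := hg' y₀ t₀ ht₀.ge
      obtain ⟨k, c, -, hkc⟩ :=
        exists_affine_le_of_separation hbot (by linarith) hx' hg'
      exact ⟨k, c, hkc⟩
    have hpos : 0 < u - h x := by linarith
    set l : ℝ := max 0 ((r - k x - c) / (u - h x))
    have hl : 0 ≤ l := le_max_left _ _
    refine ⟨k - l • h, c + l * u, ?_, fun y => ?_⟩
    · have := (div_le_iff₀ hpos).1 (le_max_right 0 ((r - k x - c) / (u - h x)))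
      simp only [sub_apply, smul_apply, smul_eq_mul]
      linarith
    · by_cases htop : g y = ⊤
      · simp [htop]
      · refine le_trans ?_ (hkc y)
        have := hg y _ (EReal.coe_toReal htop (hbot y)).ge
        simp only [sub_apply, smul_apply, smul_eq_mul,
          EReal.coe_le_coe_iff]
        nlinarith

/-- The nontrivial inequality of the Fenchel–Moreau theorem. -/
theorem exists_fenchel_le_of_lt (hbot : ∀ y, g y ≠ ⊥) (hlsc : LowerSemicontinuous g)
    (hconv : ∀ (x y : E) (θ : ℝ), 0 ≤ θ → θ ≤ 1 →
      g (θ • x + (1 - θ) • y) ≤ (θ : EReal) * g x + ((1 - θ : ℝ) : EReal) * g y)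
    {x : E} {r : ℝ} (hr : (r : EReal) < g x) :
    ∃ k : E →L[ℝ] ℝ, fenchel g k ≤ ((k x - r : ℝ) : EReal) := by
  obtain ⟨k, c, hx, hk⟩ := exists_affine_le_of_lt hbot hlsc hconv hr
  refine ⟨k, iSup_le fun y => ?_⟩
  refine (EReal.sub_le_sub le_rfl (hk y)).trans ?_
  rw [← EReal.coe_sub, EReal.coe_le_coe_iff]
  linarith

end AffineMinorant

/-- Toland–Singer duality: the Legendre–Fenchel transform preserves (reversing
direction) the generalized asymmetric distance on closed convex functions. -/
theorem toland_singer {E : Type*} [NormedAddCommGroup E] [NormedSpace ℝ E]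
    (f f' : E → EReal) (hf : ∀ x : E, f x ≠ ⊥) (hf' : ∀ x : E, f' x ≠ ⊥)
    (hlsc : LowerSemicontinuous f')
    (hconv : ∀ (x y : E) (θ : ℝ), 0 ≤ θ → θ ≤ 1 →
      f' (θ • x + (1 - θ) • y) ≤ (θ : EReal) * f' x + ((1 - θ : ℝ) : EReal) * f' y) :
    (⨆ x : E, (f' x - f x)) = ⨆ k : E →L[ℝ] ℝ, (fenchel f k - fenchel f' k) := by
  apply le_antisymm
  · refine iSup_le fun x => ?_
    by_cases htop : f x = ⊤
    · simp [htop]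
    obtain ⟨s, hs⟩ : ∃ s : ℝ, (s : EReal) = f x := ⟨_, EReal.coe_toReal htop (hf x)⟩
    rw [← hs]
    refine EReal.sub_le_of_le_add (EReal.ge_of_forall_gt_iff_ge.1 fun r hr => ?_)
    obtain ⟨k, hk⟩ := exists_fenchel_le_of_lt hf' hlsc hconv hr
    have h₁ : ((k x - s : ℝ) : EReal) ≤ fenchel f k := by
      rw [EReal.coe_sub, hs]
      exact le_iSup (fun x => (k x : EReal) - f x) x
    calc (r : EReal) = ((k x - s : ℝ) : EReal) - ((k x - r : ℝ) : EReal) + s := by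
          norm_cast
          ring
      _ ≤ _ := by
          gcongr
          exact (EReal.sub_le_sub h₁ hk).trans
            (le_iSup (fun k => fenchel f k - fenchel f' k) k)
  · by_cases hD : (⨆ x, (f' x - f x)) = ⊤
    · simp [hD]
    refine iSup_le fun k => EReal.sub_le_of_le_add (iSup_le fun x => ?_)
    by_cases htop : f x = ⊤
    · simp [htop]
    have h₁ : (k x : EReal) - f' x ≤ fenchel f' k := le_iSup (fun x => (k x : EReal) - f' x) x
    have h₂ : f' x - f x ≤ ⨆ x, (f' x - f x) := le_iSup (fun x => f' x - f x) x
    have htop' : f' x ≠ ⊤ := fun h => hD (top_le_iff.1 (by rwa [h, EReal.top_sub htop] at h₂))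
    refine le_trans (le_of_eq ?_) (add_le_add h₂ h₁)
    lift f x to ℝ using ⟨htop, hf x⟩ with s
    lift f' x to ℝ using ⟨htop', hf' x⟩ with t
    norm_cast
    ring
end
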